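/- arXiv:2410.22075 — 8 statements merged into one kernel-verified Lean document; each statement's English description precedes it below -/
import Mathlib

section
/- Let d ≥ 10 be an integer and set q := ⌊d/10⌋. Let x ∈ 8ℤ^d, let y = x + 8εe_i for some ε ∈ {−1,+1} and some 1 ≤ i ≤ d, let ℓ ⊂ ℝ^d be the straight line segment from x to y, and let T := {z ∈ ℤ^d : the ℓ¹-distance from z to ℓ is at most 2} be the associated tube. For w ∈ ℝ^d let B_w denote the unique box of the form v + [0,8)^d with v ∈ 8ℤ^d that contains w. Then: (i) for every z ∈ T with |x − z|_1 = 1 there exist q self-avoiding nearest-neighbor paths in T, each consisting of 11 vertices, each starting at z and ending at a vertex at ℓ¹-distance 1 from y, such that any two of these paths intersect only at their common starting point z, and each path starts in B_x ∪ B_z, has all its vertices in B_x ∪ B_y ∪ B_z, and ends in B_y; (ii) there exist q pairwise disjoint self-avoiding nearest-neighbor paths in T, each consisting of 11 vertices, each starting at a vertex at ℓ¹-distance 1 from x and ending at a vertex at ℓ¹-distance 1 from y, and each path starts in B_x, has all its vertices in B_x ∪ B_y, and ends in B_y. -/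
/-- A self-avoiding nearest-neighbor path in `ℤ^d` with 11 vertices: an injective sequence
of lattice points in which consecutive points are at `ℓ¹`-distance 1. -/
def IsSAPath11 (d : ℕ) (p : Fin 11 → (Fin d → ℤ)) : Prop :=
  Function.Injective p ∧
    ∀ i : Fin 10, (∑ j, |p i.succ j - p i.castSucc j|) = 1

/-- `u` lies in the tube `T_{x,y}`: the `ℓ¹`-distance from `u` to the straight segment `ℓ`
from `x` to `y` (in `ℝ^d`) is at most 2, expressed via a witness point on the segment
(the segment is compact, so the distance is attained). -/
def InTube (d : ℕ) (x y u : Fin d → ℤ) : Prop :=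
  ∃ w ∈ segment ℝ (fun j => (x j : ℝ)) (fun j => (y j : ℝ)),
    (∑ j, |(u j : ℝ) - w j|) ≤ 2

/-- `u` lies in the box `B_w`, the unique box of the form `v + [0,8)^d` with `v ∈ 8ℤ^d`
containing `w` (for lattice points `w, u`): in each coordinate, `w` and `u` lie in the same
interval `[8m, 8m + 8)`. -/
def InBox8 (d : ℕ) (w u : Fin d → ℤ) : Prop :=
  ∀ j, ∃ m : ℤ, 8 * m ≤ w j ∧ w j < 8 * m + 8 ∧ 8 * m ≤ u j ∧ u j < 8 * m + 8

/-- The lattice point `x + t e_i + a e_k + b e_l`. -/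
def tubePoint {d : ℕ} (x : Fin d → ℤ) (i k l : Fin d) (t a b : ℤ) : Fin d → ℤ := fun j =>
  x j + (if j = i then t else 0) + (if j = k then a else 0) + (if j = l then b else 0)

section TubePoint

variable {d : ℕ} {x : Fin d → ℤ} {i k l : Fin d}

lemma tubePoint_apply_fst (hk : k ≠ i) (hl : l ≠ i) (t a b : ℤ) :
    tubePoint x i k l t a b i = x i + t := by
  simp [tubePoint, hk.symm, hl.symm]

lemma tubePoint_apply_snd (hk : k ≠ i) (hkl : k ≠ l) (t a b : ℤ) :
    tubePoint x i k l t a b k = x k + a := by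
  simp [tubePoint, hk, hkl]

lemma tubePoint_apply_thd (hl : l ≠ i) (hkl : k ≠ l) (t a b : ℤ) :
    tubePoint x i k l t a b l = x l + b := by
  simp [tubePoint, hl, hkl.symm]

lemma tubePoint_apply_of_ne {j : Fin d} (hi : j ≠ i) (hk : j ≠ k) (hl : j ≠ l) (t a b : ℤ) :
    tubePoint x i k l t a b j = x j := by
  simp [tubePoint, hi, hk, hl]

lemma sum_abs_three (hk : k ≠ i) (hl : l ≠ i) (hkl : k ≠ l) {R : Type*} [AddCommGroup R]
    [LinearOrder R] [IsOrderedAddMonoid R] (t a b : R) :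
    ∑ j, |(if j = i then t else 0) + (if j = k then a else 0) + (if j = l then b else 0)| =
      |t| + |a| + |b| := by
  have h : ∀ j : Fin d,
      |(if j = i then t else 0) + (if j = k then a else 0) + (if j = l then b else 0)| =
      (if j = i then |t| else 0) + (if j = k then |a| else 0) + (if j = l then |b| else 0) := by
    intro j
    split_ifs <;> simp_all
  simp [h, Finset.sum_add_distrib]

lemma sum_abs_tubePoint_sub (hk : k ≠ i) (hl : l ≠ i) (hkl : k ≠ l) (t a b t' a' b' : ℤ) :
    ∑ j, |tubePoint x i k l t a b j - tubePoint x i k l t' a' b' j| =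
      |t - t'| + |a - a'| + |b - b'| := by
  rw [← sum_abs_three hk hl hkl]
  refine Finset.sum_congr rfl fun j _ => congrArg _ ?_
  unfold tubePoint
  split_ifs <;> ring

lemma inTube_tubePoint {y : Fin d → ℤ} {ε : ℤ} (hε : ε = 1 ∨ ε = -1)
    (hy : ∀ j, y j = x j + (if j = i then 8 * ε else 0))
    (hk : k ≠ i) (hl : l ≠ i) (hkl : k ≠ l) {t a b : ℤ}
    (h : max 0 (-t) + max 0 (t - 8) + a.natAbs + b.natAbs ≤ 2) :
    InTube d x y (tubePoint x i k l (ε * t) a b) := by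
  obtain ⟨s, hs0, hs8, hs⟩ :
      ∃ s : ℤ, 0 ≤ s ∧ s ≤ 8 ∧ |ε * t - ε * s| + |a| + |b| ≤ 2 := by
    refine ⟨max 0 (min t 8), by omega, by omega, ?_⟩
    simp only [Int.abs_eq_natAbs]
    rcases hε with rfl | rfl <;> omega
  have hs0' : (0 : ℝ) ≤ s := by exact_mod_cast hs0
  have hs8' : (s : ℝ) ≤ 8 := by exact_mod_cast hs8
  refine ⟨fun j => (tubePoint x i k l (ε * s) 0 0 j : ℝ),
    ⟨1 - s / 8, s / 8, by linarith, by linarith, by ring, ?_⟩, ?_⟩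
  · funext j
    simp only [Pi.add_apply, Pi.smul_apply, smul_eq_mul, hy, tubePoint]
    split_ifs <;> push_cast <;> ring
  · have := sum_abs_tubePoint_sub (x := x) hk hl hkl (ε * t) a b (ε * s) 0 0
    rw [sub_zero, sub_zero] at this
    rw [← this] at hs
    beta_reduce
    exact_mod_cast hs

lemma inBox8_tubePoint (hx : ∀ j, (8 : ℤ) ∣ x j) (hk : k ≠ i) (hl : l ≠ i) (hkl : k ≠ l)
    {t a b t' a' b' : ℤ} (h : t / 8 = t' / 8 ∧ a / 8 = a' / 8 ∧ b / 8 = b' / 8) :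
    InBox8 d (tubePoint x i k l t a b) (tubePoint x i k l t' a' b') := by
  obtain ⟨ht, ha, hb⟩ := h
  intro j
  obtain ⟨c, hc⟩ := hx j
  by_cases hji : j = i
  · subst hji
    rw [tubePoint_apply_fst hk hl, tubePoint_apply_fst hk hl]
    exact ⟨c + t / 8, by omega, by omega, by omega, by omega⟩
  by_cases hjk : j = k
  · subst hjk
    rw [tubePoint_apply_snd hk hkl, tubePoint_apply_snd hk hkl]
    exact ⟨c + a / 8, by omega, by omega, by omega, by omega⟩
  by_cases hjl : j = l
  · subst hjl
    rw [tubePoint_apply_thd hl hkl, tubePoint_apply_thd hl hkl]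
    exact ⟨c + b / 8, by omega, by omega, by omega, by omega⟩
  rw [tubePoint_apply_of_ne hji hjk hjl, tubePoint_apply_of_ne hji hjk hjl]
  exact ⟨c, by omega, by omega, by omega, by omega⟩

lemma isSAPath11_tubePoint (hk : k ≠ i) (hl : l ≠ i) (hkl : k ≠ l) {t a b : Fin 11 → ℤ}
    (hinj : ∀ m n, t m = t n → a m = a n → b m = b n → m = n)
    (hstep : ∀ n : Fin 10, (t n.succ - t n.castSucc).natAbs + (a n.succ - a n.castSucc).natAbs
      + (b n.succ - b n.castSucc).natAbs = 1) :
    IsSAPath11 d (fun n => tubePoint x i k l (t n) (a n) (b n)) := by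
  refine ⟨fun m n h => hinj m n ?_ ?_ ?_, fun n => ?_⟩
  · simpa [tubePoint_apply_fst hk hl] using congrFun h i
  · simpa [tubePoint_apply_snd hk hkl] using congrFun h k
  · simpa [tubePoint_apply_thd hl hkl] using congrFun h l
  · have := hstep n
    rw [sum_abs_tubePoint_sub hk hl hkl]
    simp only [Int.abs_eq_natAbs]
    omega

/-- If `k` is not among the directions of the second point, equality forces its `k`-th
displacement to vanish. -/
lemma tubePoint_snd_eq_zero {k' l' : Fin d} (hk : k ≠ i) (hkl : k ≠ l) (hkk' : k ≠ k')
    (hkl' : k ≠ l') {t a b t' a' b' : ℤ}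
    (h : tubePoint x i k l t a b = tubePoint x i k' l' t' a' b') : a = 0 := by
  have := congrFun h k
  rw [tubePoint_apply_snd hk hkl, tubePoint_apply_of_ne hk hkk' hkl'] at this
  omega

lemma tubePoint_thd_eq_zero {k' l' : Fin d} (hl : l ≠ i) (hkl : k ≠ l) (hlk' : l ≠ k')
    (hll' : l ≠ l') {t a b t' a' b' : ℤ}
    (h : tubePoint x i k l t a b = tubePoint x i k' l' t' a' b') : b = 0 := by
  have := congrFun h l
  rw [tubePoint_apply_thd hl hkl, tubePoint_apply_of_ne hl hlk' hll'] at this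
  omega

lemma eq_tubePoint_zero : x = tubePoint x i k l 0 0 0 := by
  funext j
  simp [tubePoint]

lemma eq_tubePoint_fst {z : Fin d → ℤ} {t : ℤ} (hz : ∀ j, z j = x j + (if j = i then t else 0)) :
    z = tubePoint x i k l t 0 0 := by
  funext j
  simp [tubePoint, hz]

lemma eq_tubePoint_thd {z : Fin d → ℤ} {b : ℤ} (hz : ∀ j, z j = x j + (if j = l then b else 0)) :
    z = tubePoint x i k l 0 0 b := by
  funext j
  simp [tubePoint, hz]

end TubePoint

lemma exists_unit_step_of_sum_abs_sub_eq_one {d : ℕ} {x z : Fin d → ℤ}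
    (h : ∑ j, |x j - z j| = 1) :
    ∃ (m : Fin d) (s : ℤ), (s = 1 ∨ s = -1) ∧ ∀ j, z j = x j + (if j = m then s else 0) := by
  simp only [Int.abs_eq_natAbs] at h
  obtain ⟨m, -, hm⟩ : ∃ m ∈ Finset.univ, ((x m - z m).natAbs : ℤ) ≠ 0 :=
    Finset.exists_ne_zero_of_sum_ne_zero (by omega)
  have hsplit := Finset.add_sum_erase Finset.univ (fun j => ((x j - z j).natAbs : ℤ)) (Finset.mem_univ m)
  have hnonneg : 0 ≤ ∑ j ∈ Finset.univ.erase m, ((x j - z j).natAbs : ℤ) :=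
    Finset.sum_nonneg fun j _ => Int.natCast_nonneg _
  refine ⟨m, z m - x m, by omega, fun j => ?_⟩
  split_ifs with hj
  · subst hj; ring
  · have hle := Finset.single_le_sum (f := fun j => ((x j - z j).natAbs : ℤ)) (fun j _ => Int.natCast_nonneg _)
      (Finset.mem_erase.2 ⟨hj, Finset.mem_univ j⟩)
    omega

lemma exists_disjoint_directions {d : ℕ} (hd : 10 ≤ d) (i m : Fin d) :
    ∃ κ μ : Fin (d / 10) → Fin d, (∀ a, κ a ≠ i) ∧ (∀ a, κ a ≠ m) ∧ (∀ a, μ a ≠ i) ∧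
      (∀ a b, κ a ≠ μ b) ∧ (∀ a b, a ≠ b → κ a ≠ κ b) ∧ ∀ a b, a ≠ b → μ a ≠ μ b := by
  have hcard : Fintype.card (Fin (d / 10) ⊕ Fin (d / 10)) ≤
      Fintype.card {j : Fin d // j ∉ ({i, m} : Finset (Fin d))} := by
    have h2 : ({i, m} : Finset (Fin d)).card ≤ 2 := Finset.card_le_two
    rw [Fintype.card_subtype_compl, Fintype.card_sum, Fintype.card_fin, Fintype.card_fin,
      Fintype.card_coe]
    omega
  obtain ⟨f⟩ := Function.Embedding.nonempty_of_card_le hcard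
  have hf : ∀ u, (f u : Fin d) ≠ i ∧ (f u : Fin d) ≠ m := fun u => by simpa using (f u).2
  have hne : ∀ u v, u ≠ v → (f u : Fin d) ≠ f v := fun u v huv h =>
    huv (f.injective (Subtype.ext h))
  exact ⟨fun a => f (.inl a), fun a => f (.inr a), fun a => (hf _).1, fun a => (hf _).2,
    fun a => (hf _).1, fun a b => hne _ _ (by simp), fun a b h => hne _ _ (by simpa using h),
    fun a b h => hne _ _ (by simpa using h)⟩

/-- A family of paths out of a common vertex, obtained by moving along `(t, a, b)` in the
directions `e_i, e_{κ c}, e_{μ c}`. -/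
lemma exists_tube_paths_from {d : ℕ} {x y z : Fin d → ℤ} (hx : ∀ j, (8 : ℤ) ∣ x j)
    {ε : ℤ} (hε : ε = 1 ∨ ε = -1) {i : Fin d}
    (hy : ∀ j, y j = x j + (if j = i then 8 * ε else 0))
    {κ μ : Fin (d / 10) → Fin d} (hκ : ∀ c, κ c ≠ i) (hμ : ∀ c, μ c ≠ i)
    (hκμ : ∀ c, κ c ≠ μ c) (t a b : Fin 11 → ℤ)
    (hz : ∀ c, z = tubePoint x i (κ c) (μ c) (ε * t 0) (a 0) (b 0))
    (hinj : ∀ m n, ε * t m = ε * t n → a m = a n → b m = b n → m = n)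
    (hstep : ∀ n : Fin 10, (ε * t n.succ - ε * t n.castSucc).natAbs +
      (a n.succ - a n.castSucc).natAbs + (b n.succ - b n.castSucc).natAbs = 1)
    (htube : ∀ n, max 0 (-t n) + max 0 (t n - 8) + (a n).natAbs + (b n).natAbs ≤ 2)
    (hend : (ε * t 10 - 8 * ε).natAbs + (a 10).natAbs + (b 10).natAbs = 1)
    (hdisj : ∀ c c', c ≠ c' → ∀ m n,
      tubePoint x i (κ c) (μ c) (ε * t m) (a m) (b m) =
        tubePoint x i (κ c') (μ c') (ε * t n) (a n) (b n) → m = 0)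
    (hbox : ∀ n, (0 / 8 = ε * t n / 8 ∧ 0 / 8 = a n / 8 ∧ 0 / 8 = b n / 8) ∨
      (8 * ε / 8 = ε * t n / 8 ∧ 0 / 8 = a n / 8 ∧ 0 / 8 = b n / 8) ∨
      (ε * t 0 / 8 = ε * t n / 8 ∧ a 0 / 8 = a n / 8 ∧ b 0 / 8 = b n / 8))
    (hboxend : 8 * ε / 8 = ε * t 10 / 8 ∧ 0 / 8 = a 10 / 8 ∧ 0 / 8 = b 10 / 8) :
    ∃ p : Fin (d / 10) → Fin 11 → (Fin d → ℤ),
        (∀ a, IsSAPath11 d (p a)) ∧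
        (∀ a k, InTube d x y (p a k)) ∧
        (∀ a, p a 0 = z) ∧
        (∀ a, (∑ j, |p a 10 j - y j|) = 1) ∧
        (∀ a b, a ≠ b → ∀ k l, p a k = p b l → p a k = z) ∧
        (∀ a, InBox8 d x (p a 0) ∨ InBox8 d z (p a 0)) ∧
        (∀ a k, InBox8 d x (p a k) ∨ InBox8 d y (p a k) ∨ InBox8 d z (p a k)) ∧
        (∀ a, InBox8 d y (p a 10)) := by
  have box {c : Fin (d / 10)} {t a b t' a' b' : ℤ} :=
    inBox8_tubePoint (t := t) (a := a) (b := b) (t' := t') (a' := a') (b' := b')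
      hx (hκ c) (hμ c) (hκμ c)
  have hx0 (c) : x = tubePoint x i (κ c) (μ c) 0 0 0 := eq_tubePoint_zero
  have hy0 (c) : y = tubePoint x i (κ c) (μ c) (8 * ε) 0 0 := eq_tubePoint_fst hy
  refine ⟨fun c n => tubePoint x i (κ c) (μ c) (ε * t n) (a n) (b n),
    fun c => isSAPath11_tubePoint (hκ c) (hμ c) (hκμ c) hinj hstep,
    fun c n => inTube_tubePoint hε hy (hκ c) (hμ c) (hκμ c) (htube n),
    fun c => (hz c).symm, fun c => ?_, fun c c' hcc m n h => ?_, fun c => Or.inr ?_,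
    fun c n => ?_, fun c => ?_⟩
  · rw [hy0 c, sum_abs_tubePoint_sub (hκ c) (hμ c) (hκμ c)]
    simp only [Int.abs_eq_natAbs]
    omega
  · simp only [hdisj c c' hcc m n h]
    exact (hz c).symm
  · conv => arg 2; rw [hz c]
    exact box ⟨rfl, rfl, rfl⟩
  · rcases hbox n with h | h | h
    · left
      conv => arg 2; rw [hx0 c]
      exact box h
    · right; left
      conv => arg 2; rw [hy0 c]
      exact box h
    · right; right
      conv => arg 2; rw [hz c]
      exact box h
  · conv => arg 2; rw [hy0 c]
    exact box hboxend

/-- Construction of `q = ⌊d/10⌋` almost-disjoint self-avoiding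
nearest-neighbor paths of length 11 in a tube `T_{x,y}`, with (i) a prescribed common
starting point `z`, the paths pairwise intersecting only at `z`, and (ii) pairwise
disjoint paths; with the stated membership of the vertices in the boxes
`B_x, B_y, B_z`. -/
theorem tube_paths (d : ℕ) (hd : 10 ≤ d) (x : Fin d → ℤ) (hx : ∀ j, (8 : ℤ) ∣ x j)
    (ε : ℤ) (hε : ε = 1 ∨ ε = -1) (i : Fin d) (y : Fin d → ℤ)
    (hy : ∀ j, y j = x j + (if j = i then 8 * ε else 0)) :
    (∀ z : Fin d → ℤ, InTube d x y z → (∑ j, |x j - z j|) = 1 →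
      ∃ p : Fin (d / 10) → Fin 11 → (Fin d → ℤ),
        (∀ a, IsSAPath11 d (p a)) ∧
        (∀ a k, InTube d x y (p a k)) ∧
        (∀ a, p a 0 = z) ∧
        (∀ a, (∑ j, |p a 10 j - y j|) = 1) ∧
        (∀ a b, a ≠ b → ∀ k l, p a k = p b l → p a k = z) ∧
        (∀ a, InBox8 d x (p a 0) ∨ InBox8 d z (p a 0)) ∧
        (∀ a k, InBox8 d x (p a k) ∨ InBox8 d y (p a k) ∨ InBox8 d z (p a k)) ∧
        (∀ a, InBox8 d y (p a 10))) ∧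
    (∃ p : Fin (d / 10) → Fin 11 → (Fin d → ℤ),
        (∀ a, IsSAPath11 d (p a)) ∧
        (∀ a k, InTube d x y (p a k)) ∧
        (∀ a, (∑ j, |p a 0 j - x j|) = 1) ∧
        (∀ a, (∑ j, |p a 10 j - y j|) = 1) ∧
        (∀ a b, a ≠ b → ∀ k l, p a k ≠ p b l) ∧
        (∀ a, InBox8 d x (p a 0)) ∧
        (∀ a k, InBox8 d x (p a k) ∨ InBox8 d y (p a k)) ∧
        (∀ a, InBox8 d y (p a 10))) := by
  refine ⟨fun z _ hxz => ?_, ?_⟩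
  · obtain ⟨m, s, hs, hz⟩ := exists_unit_step_of_sum_abs_sub_eq_one hxz
    obtain ⟨κ, μ, hκ, hκm, hμ, hκμ, hκκ, hμμ⟩ := exists_disjoint_directions hd i m
    by_cases hmi : m = i
    · subst hmi
      have hsε : s = ε ∨ s = -ε := by omega
      rcases hsε with rfl | rfl
      · refine exists_tube_paths_from hx hε hy hκ hμ (fun c => hκμ c c)
          ![1, 1, 1, 2, 3, 4, 5, 6, 7, 8, 8] ![0, 1, 1, 1, 1, 1, 1, 1, 1, 1, 0]
          ![0, 0, 1, 1, 1, 1, 1, 1, 1, 1, 1] (fun c => ?_) ?_ ?_ ?_ ?_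
          (fun c c' hcc n n' h => ?_) ?_ ?_
        · simpa using eq_tubePoint_fst hz
        rotate_left 4
        · have h1 := tubePoint_snd_eq_zero (hκ c) (hκμ c c) (hκκ c c' hcc) (hκμ c c') h
          have h2 := tubePoint_thd_eq_zero (hμ c) (hκμ c c) (hκμ c' c).symm (hμμ c c' hcc) h
          clear h
          revert n
          decide
        all_goals rcases hε with rfl | rfl <;> decide
      · refine exists_tube_paths_from hx hε hy hκ hμ (fun c => hκμ c c)
          ![-1, -1, 0, 1, 2, 3, 4, 5, 6, 7, 8] ![0, 1, 1, 1, 1, 1, 1, 1, 1, 1, 1]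
          (fun _ => 0) (fun c => ?_) ?_ ?_ ?_ ?_ (fun c c' hcc n n' h => ?_) ?_ ?_
        · simpa using eq_tubePoint_fst hz
        rotate_left 4
        · have h1 := tubePoint_snd_eq_zero (hκ c) (hκμ c c) (hκκ c c' hcc) (hκμ c c') h
          clear h
          revert n
          decide
        all_goals rcases hε with rfl | rfl <;> decide
    · refine exists_tube_paths_from hx hε hy hκ (fun _ => hmi) hκm
        ![0, 0, 0, 1, 2, 3, 4, 5, 6, 7, 8] ![0, 1, 1, 1, 1, 1, 1, 1, 1, 1, 1]
        ![s, s, 0, 0, 0, 0, 0, 0, 0, 0, 0] (fun c => ?_) ?_ ?_ ?_ ?_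
        (fun c c' hcc n n' h => ?_) ?_ ?_
      · simpa using eq_tubePoint_thd hz
      rotate_left 4
      · have h1 := tubePoint_snd_eq_zero (hκ c) (hκm c) (hκκ c c' hcc) (hκm c) h
        clear h
        revert n
        decide
      all_goals rcases hε with rfl | rfl <;> rcases hs with rfl | rfl <;> decide
  · obtain ⟨κ, μ, hκ, -, hμ, hκμ, hκκ, hμμ⟩ := exists_disjoint_directions hd i i
    let t : Fin 11 → ℤ := ![0, 0, 1, 2, 3, 4, 5, 6, 7, 8, 8]
    let a : Fin 11 → ℤ := ![1, 1, 1, 1, 1, 1, 1, 1, 1, 1, 0]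
    let b : Fin 11 → ℤ := ![0, 1, 1, 1, 1, 1, 1, 1, 1, 1, 1]
    have hinj : ∀ m n, ε * t m = ε * t n → a m = a n → b m = b n → m = n := by
      rcases hε with rfl | rfl <;> decide
    have hstep : ∀ n : Fin 10, (ε * t n.succ - ε * t n.castSucc).natAbs +
        (a n.succ - a n.castSucc).natAbs + (b n.succ - b n.castSucc).natAbs = 1 := by
      rcases hε with rfl | rfl <;> decide
    have htube : ∀ n, max 0 (-t n) + max 0 (t n - 8) + (a n).natAbs + (b n).natAbs ≤ 2 := by
      decide
    have hab : ∀ n, ¬(a n = 0 ∧ b n = 0) := by decide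
    have hbox : ∀ n, (0 / 8 = ε * t n / 8 ∧ 0 / 8 = a n / 8 ∧ 0 / 8 = b n / 8) ∨
        (8 * ε / 8 = ε * t n / 8 ∧ 0 / 8 = a n / 8 ∧ 0 / 8 = b n / 8) := by
      rcases hε with rfl | rfl <;> decide
    have box {c : Fin (d / 10)} {t a b t' a' b' : ℤ} :=
      inBox8_tubePoint (t := t) (a := a) (b := b) (t' := t') (a' := a') (b' := b')
        hx (hκ c) (hμ c) (hκμ c c)
    have hx0 (c) : x = tubePoint x i (κ c) (μ c) 0 0 0 := eq_tubePoint_zero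
    have hy0 (c) : y = tubePoint x i (κ c) (μ c) (8 * ε) 0 0 := eq_tubePoint_fst hy
    refine ⟨fun c n => tubePoint x i (κ c) (μ c) (ε * t n) (a n) (b n),
      fun c => isSAPath11_tubePoint (hκ c) (hμ c) (hκμ c c) hinj hstep,
      fun c n => inTube_tubePoint hε hy (hκ c) (hμ c) (hκμ c c) (htube n),
      fun c => ?_, fun c => ?_, fun c c' hcc m n h => ?_, fun c => ?_, fun c n => ?_, fun c => ?_⟩
    · conv => enter [1, 2, j, 1, 2]; rw [hx0 c]
      rw [sum_abs_tubePoint_sub (hκ c) (hμ c) (hκμ c c)]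
      simp [t, a, b]
    · rw [hy0 c, sum_abs_tubePoint_sub (hκ c) (hμ c) (hκμ c c)]
      simp [t, a, b, mul_comm]
    · exact hab m ⟨tubePoint_snd_eq_zero (hκ c) (hκμ c c) (hκκ c c' hcc) (hκμ c c') h,
        tubePoint_thd_eq_zero (hμ c) (hκμ c c) (hκμ c' c).symm (hμμ c c' hcc) h⟩
    · conv => arg 2; rw [hx0 c]
      exact box (by simp [t, a, b])
    · rcases hbox n with h | h
      · left
        conv => arg 2; rw [hx0 c]
        exact box h
      · right
        conv => arg 2; rw [hy0 c]
        exact box h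
    · conv => arg 2; rw [hy0 c]
      exact box (by simp [t, a, b, mul_comm])
end

section
/- For any real a > 1 there exists a constant C > 0, depending on a, such that for all real b ≥ C the following holds: if the sequence (a_i)_{i ≥ 1} is defined by a_1 = a and a_{i+1} = a·(1 + a_i^{11}/b)^2 for all i ≥ 1, then sup_{i ≥ 1} a_i ≤ 2a. -/
/-- For any real `a > 1` there exists a constant `C > 0`, depending on `a`,
such that for all real `b ≥ C` the following holds: if the sequence `(a_i)_{i ≥ 1}` is
defined by `a_1 = a` and `a_{i+1} = a * (1 + a_i^11 / b)^2` for all `i ≥ 1`, then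
`sup_{i ≥ 1} a_i ≤ 2a`. -/
theorem sequence_bound_one :
    ∀ a : ℝ, 1 < a → ∃ C : ℝ, 0 < C ∧ ∀ b : ℝ, C ≤ b →
      ∀ u : ℕ → ℝ, u 1 = a →
        (∀ i : ℕ, 1 ≤ i → u (i + 1) = a * (1 + u i ^ 11 / b) ^ 2) →
        ∀ i : ℕ, 1 ≤ i → u i ≤ 2 * a := by
  intro a ha
  have ha0 : 0 < a := by linarith
  refine ⟨3 * (2 * a) ^ 11, by positivity, fun b hb u hu1 hu i hi => ?_⟩
  have hb0 : 0 < b := lt_of_lt_of_le (by positivity) hb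
  suffices h : 0 ≤ u i ∧ u i ≤ 2 * a from h.2
  induction i, hi using Nat.le_induction with
  | base => rw [hu1]; constructor <;> linarith
  | succ n hn ih =>
    obtain ⟨hnonneg, hle⟩ := ih
    have hpow : u n ^ 11 ≤ (2 * a) ^ 11 := by gcongr
    have hratio_nonneg : 0 ≤ u n ^ 11 / b := by positivity
    have hratio_le : u n ^ 11 / b ≤ 1 / 3 := by
      rw [div_le_iff₀ hb0]
      linarith
    have hsq : (1 + u n ^ 11 / b) ^ 2 ≤ 2 := by nlinarith
    rw [hu n hn]
    exact ⟨by positivity, by nlinarith⟩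
end

section
/- For any real a > 1 there exists a constant C > 0, depending on a, such that for all real b ≥ C the following holds: if the sequence (b_i)_{i ≥ 1} is defined by b_1 = a and b_{i+1} = (1 + (b_i^{11} − 1)/b)^2 for all i ≥ 1, then b_i ≤ 1 + 2^{−i} for all integers i ≥ 2. -/
/-- On `[0, 1]`, the convex function `d ↦ (1 + d) ^ n` lies below its chord. -/
theorem one_add_pow_le_chord {d : ℝ} (hd : 0 ≤ d) (hd' : d ≤ 1) (n : ℕ) :
    (1 + d) ^ n ≤ 1 + (2 ^ n - 1) * d := by
  induction n with
  | zero => simp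
  | succ n ih =>
    have hn : (1 : ℝ) ≤ 2 ^ n := one_le_pow₀ (by norm_num)
    have hsq : (2 ^ n - 1) * (d * d) ≤ (2 ^ n - 1) * d :=
      mul_le_mul_of_nonneg_left (mul_le_of_le_one_right hd hd') (by linarith)
    calc (1 + d) ^ (n + 1) = (1 + d) ^ n * (1 + d) := pow_succ _ _
      _ ≤ (1 + (2 ^ n - 1) * d) * (1 + d) := mul_le_mul_of_nonneg_right ih (by linarith)
      _ ≤ 1 + (2 ^ (n + 1) - 1) * d := by rw [pow_succ]; linarith

/-- If `x ≥ 1` and `x ^ 11 - 1` is small compared with `b`, then `(1 + (x ^ 11 - 1) / b) ^ 2`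
lies in `[1, 1 + e]`. -/
theorem sq_one_add_div_mem_Icc {x b e : ℝ} (hx : 1 ≤ x) (hb : 0 < b) (he : e ≤ 1)
    (h : 3 * (x ^ 11 - 1) ≤ e * b) :
    (1 + (x ^ 11 - 1) / b) ^ 2 ∈ Set.Icc 1 (1 + e) := by
  have ht : 0 ≤ (x ^ 11 - 1) / b := div_nonneg (by linarith [one_le_pow₀ (n := 11) hx]) hb.le
  have ht' : 3 * ((x ^ 11 - 1) / b) ≤ e := by rwa [← mul_div_assoc, div_le_iff₀ hb]
  constructor <;> nlinarith


/-- For any real `a > 1` there exists a constant `C > 0`, depending on `a`,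
such that for all real `b ≥ C` the following holds: if the sequence `(b_i)_{i ≥ 1}` is
defined by `b_1 = a` and `b_{i+1} = (1 + (b_i^11 − 1)/b)^2` for all `i ≥ 1`, then
`b_i ≤ 1 + 2^{−i}` for all integers `i ≥ 2`. -/
theorem sequence_bound_two :
    ∀ a : ℝ, 1 < a → ∃ C : ℝ, 0 < C ∧ ∀ b : ℝ, C ≤ b →
      ∀ u : ℕ → ℝ, u 1 = a →
        (∀ i : ℕ, 1 ≤ i → u (i + 1) = (1 + (u i ^ 11 - 1) / b) ^ 2) →
        ∀ i : ℕ, 2 ≤ i → u i ≤ 1 + (2 : ℝ) ^ (-(i : ℤ)) := by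
  intro a ha
  have ha₀ : 0 < a ^ 11 := by positivity
  refine ⟨20000 + 12 * a ^ 11, by positivity, fun b hb u hu₁ hu i hi => ?_⟩
  suffices h : u i ∈ Set.Icc 1 (1 + (1 / 2 : ℝ) ^ i) by
    simpa [zpow_neg, inv_pow] using h.2
  induction i, hi using Nat.le_induction with
  | base =>
    rw [hu 1 le_rfl, hu₁]
    exact sq_one_add_div_mem_Icc ha.le (by linarith) (by norm_num) (by linarith)
  | succ i hi ih =>
    have hd₀ : (0 : ℝ) < (1 / 2) ^ i := by positivity
    have hd₁ : (1 / 2 : ℝ) ^ i ≤ 1 := pow_le_one₀ (by norm_num) (by norm_num)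
    rw [hu i (by lia), pow_succ]
    refine sq_one_add_div_mem_Icc ih.1 (by linarith) (by linarith) ?_
    have hpow := (pow_le_pow_left₀ (by linarith [ih.1]) ih.2 11).trans
      (one_add_pow_le_chord hd₀.le hd₁ 11)
    nlinarith
end

section
/- For any fixed t > 0 there exists a constant c_2 = c_2(t) > 0 such that for every integer d ≥ c_2^{−1} and all x, y ∈ ℝ^d with |x − y|_2 ≤ t/√d, one has vol(B_1(x) ∩ B_1(y)) ≥ c_2 · vol(B_1(0)). -/
open MeasureTheory
open scoped Pointwise

/-- The second moment of a linear functional over the unit ball depends only on its norm. -/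
lemma setLIntegral_unitBall_inner_sq_eq {d : ℕ} {v w : EuclideanSpace ℝ (Fin d)}
    (hvw : ‖v‖ = ‖w‖) :
    ∫⁻ u in Metric.ball (0 : EuclideanSpace ℝ (Fin d)) 1, ENNReal.ofReal (inner ℝ u v ^ 2) =
      ∫⁻ u in Metric.ball (0 : EuclideanSpace ℝ (Fin d)) 1, ENNReal.ofReal (inner ℝ u w ^ 2) := by
  set R := (ℝ ∙ (v - w))ᗮ.reflection
  have hR : R v = w := Submodule.reflection_sub hvw
  have hball : R ⁻¹' Metric.ball 0 1 = Metric.ball 0 1 := by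
    rw [R.preimage_ball]; simp
  have h := R.measurePreserving.setLIntegral_comp_preimage (s := Metric.ball 0 1)
    Metric.isOpen_ball.measurableSet
    (f := fun u => ENNReal.ofReal (inner ℝ u w ^ 2)) (by fun_prop)
  rw [hball] at h
  rw [← h]
  refine lintegral_congr fun u => ?_
  rw [← hR, R.inner_map_map]

lemma mul_setLIntegral_unitBall_inner_sq_le {d : ℕ} (v : EuclideanSpace ℝ (Fin d)) :
    d * ∫⁻ u in Metric.ball (0 : EuclideanSpace ℝ (Fin d)) 1, ENNReal.ofReal (inner ℝ u v ^ 2) ≤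
      ENNReal.ofReal (‖v‖ ^ 2) * volume (Metric.ball (0 : EuclideanSpace ℝ (Fin d)) 1) := by
  calc _ = ∑ i : Fin d, ∫⁻ u in Metric.ball (0 : EuclideanSpace ℝ (Fin d)) 1,
        ENNReal.ofReal (inner ℝ u (EuclideanSpace.single i ‖v‖) ^ 2) := by
        rw [Finset.sum_congr rfl fun i _ =>
          (setLIntegral_unitBall_inner_sq_eq (v := v) (w := EuclideanSpace.single i ‖v‖)
            (by simp)).symm]
        simp
    _ = ∫⁻ u in Metric.ball (0 : EuclideanSpace ℝ (Fin d)) 1,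
        ∑ i : Fin d, ENNReal.ofReal (inner ℝ u (EuclideanSpace.single i ‖v‖) ^ 2) := by
        rw [lintegral_finsetSum]
        fun_prop
    _ ≤ ∫⁻ _ in Metric.ball (0 : EuclideanSpace ℝ (Fin d)) 1, ENNReal.ofReal (‖v‖ ^ 2) := by
        refine setLIntegral_mono measurable_const fun u hu => ?_
        rw [← ENNReal.ofReal_sum_of_nonneg fun i _ => sq_nonneg _]
        refine ENNReal.ofReal_le_ofReal ?_
        have hu' : ‖u‖ ^ 2 ≤ 1 := by
          rw [mem_ball_zero_iff] at hu
          exact pow_le_one₀ (norm_nonneg u) hu.le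
        have hsum : ∑ i : Fin d, inner ℝ u (EuclideanSpace.single i ‖v‖) ^ 2 =
            ‖v‖ ^ 2 * ‖u‖ ^ 2 := by
          rw [EuclideanSpace.real_norm_sq_eq u, Finset.mul_sum]
          refine Finset.sum_congr rfl fun i _ => ?_
          simp [EuclideanSpace.inner_single_right, mul_pow]
        rw [hsum]
        exact mul_le_of_le_one_right (sq_nonneg _) hu'
    _ = _ := by simp

/-- Most of the unit ball lies in a slab of width of order `1 / √d`. -/
lemma half_volume_unitBall_le_volume_slab {d : ℕ} (hd : 0 < d) {t : ℝ} (ht : 0 < t)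
    {h : EuclideanSpace ℝ (Fin d)} (hh : ‖h‖ ^ 2 ≤ t ^ 2 / (4 * d)) :
    ENNReal.ofReal (1 / 2) * volume (Metric.ball (0 : EuclideanSpace ℝ (Fin d)) 1) ≤
      volume (Metric.ball (0 : EuclideanSpace ℝ (Fin d)) 1 ∩ {u | |inner ℝ u h| < t / d}) := by
  set B := Metric.ball (0 : EuclideanSpace ℝ (Fin d)) 1
  set S : Set (EuclideanSpace ℝ (Fin d)) := {u | |inner ℝ u h| < t / d}
  have hd' : (0 : ℝ) < d := by exact_mod_cast hd
  have hS : MeasurableSet S :=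
    (isOpen_lt (by fun_prop) continuous_const).measurableSet
  have hB : volume B ≠ ⊤ := measure_ball_lt_top.ne
  have hcheb : ENNReal.ofReal ((t / d) ^ 2) * volume (B \ S) ≤
      ∫⁻ u in B, ENNReal.ofReal (inner ℝ u h ^ 2) := by
    refine le_trans ?_ (mul_meas_ge_le_lintegral (μ := volume.restrict B)
      (f := fun u => ENNReal.ofReal (inner ℝ u h ^ 2)) (by fun_prop)
      (ENNReal.ofReal ((t / d) ^ 2)))
    refine mul_le_mul_right ?_ _
    rw [Set.sdiff_eq, Set.inter_comm, ← Measure.restrict_apply hS.compl]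
    refine measure_mono fun u hu => ENNReal.ofReal_le_ofReal ?_
    have hu' : t / d ≤ |inner ℝ u h| := not_lt.mp hu
    rw [← sq_abs (inner ℝ u h)]
    gcongr
  have hmoment := mul_setLIntegral_unitBall_inner_sq_le h
  have hmul : ENNReal.ofReal (t ^ 2 / d) * volume (B \ S) ≤
      ENNReal.ofReal (t ^ 2 / (4 * d)) * volume B := by
    calc _ = d * (ENNReal.ofReal ((t / d) ^ 2) * volume (B \ S)) := by
          rw [← mul_assoc, ← ENNReal.ofReal_natCast, ← ENNReal.ofReal_mul hd'.le]
          congr 2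
          field_simp
      _ ≤ _ := (mul_le_mul_right hcheb _).trans (hmoment.trans (by gcongr))
  have hsplit : volume.real (B ∩ S) + volume.real (B \ S) = volume.real B :=
    measureReal_inter_add_sdiff hS hB
  have hreal : t ^ 2 / d * volume.real (B \ S) ≤ t ^ 2 / (4 * d) * volume.real B := by
    have := ENNReal.toReal_mono (ENNReal.mul_ne_top ENNReal.ofReal_ne_top hB) hmul
    rwa [ENNReal.toReal_mul, ENNReal.toReal_mul, ENNReal.toReal_ofReal (by positivity),
      ENNReal.toReal_ofReal (by positivity)] at this
  have hquarter : volume.real (B \ S) ≤ volume.real B / 4 := by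
    refine le_of_mul_le_mul_left (hreal.trans_eq ?_) (by positivity : 0 < t ^ 2 / (d : ℝ))
    field_simp
  have hBnonneg : 0 ≤ volume.real B := measureReal_nonneg
  rw [← ofReal_measureReal hB,
    ← ofReal_measureReal (measure_ne_top_of_subset Set.inter_subset_left hB),
    ← ENNReal.ofReal_mul (by norm_num)]
  exact ENNReal.ofReal_le_ofReal (by linarith)

lemma exp_neg_two_mul_le_one_sub_div_pow {a : ℝ} (ha : 0 ≤ a) {d : ℕ} (hd : 0 < d)
    (had : 2 * a ≤ d) : Real.exp (-(2 * a)) ≤ (1 - a / d) ^ d := by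
  have hd' : (0 : ℝ) < d := by exact_mod_cast hd
  have hx : a / d ≤ 1 / 2 := by rw [div_le_iff₀ hd']; linarith
  have hx0 : 0 ≤ a / d := by positivity
  have hexp : Real.exp (-(2 * a)) = Real.exp (-(2 * (a / d))) ^ d := by
    rw [← Real.exp_nat_mul]
    congr 1
    field_simp
  rw [hexp]
  gcongr
  rw [Real.exp_neg]
  refine inv_le_of_inv_le₀ (by linarith) (le_trans ?_ (Real.add_one_le_exp _))
  rw [inv_le_iff_one_le_mul₀ (by linarith)]
  nlinarith

lemma norm_smul_add_lt_one {E : Type*} [NormedAddCommGroup E] [InnerProductSpace ℝ E]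
    {u h : E} {r b s : ℝ} (hr0 : 0 < r) (hr1 : r ≤ 1) (hu : ‖u‖ < 1)
    (hin : |inner ℝ u h| ≤ b) (hh : ‖h‖ ^ 2 ≤ s) (hrbs : r + 2 * b + s ≤ 1) :
    ‖r • u + h‖ < 1 := by
  have hsq : ‖r • u + h‖ ^ 2 < 1 := by
    rw [norm_add_sq_real, norm_smul, real_inner_smul_left, Real.norm_of_nonneg hr0.le]
    have h1 : (r * ‖u‖) ^ 2 < r := by
      have : r * ‖u‖ < r := mul_lt_of_lt_one_right hr0 hu
      have : 0 ≤ r * ‖u‖ := by positivity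
      nlinarith
    have h2 : r * inner ℝ u h ≤ b :=
      calc r * inner ℝ u h ≤ r * |inner ℝ u h| := by gcongr; exact le_abs_self _
        _ ≤ |inner ℝ u h| := mul_le_of_le_one_left (abs_nonneg _) hr1
        _ ≤ b := hin
    linarith
  exact (sq_lt_one_iff₀ (norm_nonneg _)).mp hsq

/-- For any fixed `t > 0` there exists a constant `c₂ = c₂(t) > 0` such that
for every integer `d ≥ c₂⁻¹` and all `x, y ∈ ℝ^d` with `|x − y|₂ ≤ t/√d`, one has
`vol(B₁(x) ∩ B₁(y)) ≥ c₂ · vol(B₁(0))`. -/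
theorem ball_intersection_lower_bound :
    ∀ t : ℝ, 0 < t → ∃ c₂ : ℝ, 0 < c₂ ∧ ∀ d : ℕ, c₂⁻¹ ≤ (d : ℝ) →
      ∀ x y : EuclideanSpace ℝ (Fin d), dist x y ≤ t / Real.sqrt d →
        ENNReal.ofReal c₂ * volume (Metric.ball (0 : EuclideanSpace ℝ (Fin d)) 1) ≤
          volume (Metric.ball x 1 ∩ Metric.ball y 1) := by
  intro t ht
  set a : ℝ := 2 * t + t ^ 2 / 4 with ha
  have ha0 : 0 < a := by positivity
  refine ⟨Real.exp (-(2 * a)) * (1 / 2), by positivity, fun d hd x y hxy => ?_⟩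
  have hda : 2 * (2 * a + 1) ≤ (d : ℝ) := by
    rw [Real.exp_neg, mul_inv, inv_inv] at hd
    have := Real.add_one_le_exp (2 * a)
    norm_num at hd
    linarith
  have hd' : (0 : ℝ) < d := by linarith
  have hd0 : 0 < d := by exact_mod_cast hd'
  set h : EuclideanSpace ℝ (Fin d) := (1 / 2 : ℝ) • (x - y) with hh
  set m : EuclideanSpace ℝ (Fin d) := (1 / 2 : ℝ) • (x + y) with hm
  have hx : x = m + h := by rw [hm, hh]; module
  have hy : y = m - h := by rw [hm, hh]; module
  have hnorm : ‖h‖ ^ 2 ≤ t ^ 2 / (4 * d) := by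
    rw [hh, norm_smul, ← dist_eq_norm, mul_pow]
    calc _ ≤ ‖(1 / 2 : ℝ)‖ ^ 2 * (t / Real.sqrt d) ^ 2 := by gcongr
      _ = _ := by
        rw [div_pow, Real.sq_sqrt hd'.le]
        norm_num
        field_simp
  set r : ℝ := 1 - a / d with hr
  have had : a / d < 1 := by rw [div_lt_one hd']; linarith
  have hr0 : 0 < r := by linarith
  have hr1 : r ≤ 1 := by rw [hr]; linarith [div_pos ha0 hd']
  have hrbs : r + 2 * (t / d) + t ^ 2 / (4 * d) ≤ 1 := by
    rw [hr, ha]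
    apply le_of_eq
    field_simp
    ring
  set G := Metric.ball (0 : EuclideanSpace ℝ (Fin d)) 1 ∩ {u | |inner ℝ u h| < t / d} with hG
  have hsub : r • G ⊆ (fun z => m + z) ⁻¹' (Metric.ball x 1 ∩ Metric.ball y 1) := by
    rintro _ ⟨u, ⟨hu, hin : |inner ℝ u h| < t / d⟩, rfl⟩
    rw [mem_ball_zero_iff] at hu
    constructor
    · rw [mem_ball_iff_norm, show m + r • u - x = r • u + -h by rw [hx]; abel]
      exact norm_smul_add_lt_one hr0 hr1 hu (by rw [inner_neg_right, abs_neg]; exact hin.le)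
        (by rwa [norm_neg]) hrbs
    · rw [mem_ball_iff_norm, show m + r • u - y = r • u + h by rw [hy]; abel]
      exact norm_smul_add_lt_one hr0 hr1 hu hin.le hnorm hrbs
  calc _ = ENNReal.ofReal (Real.exp (-(2 * a))) *
        (ENNReal.ofReal (1 / 2) * volume (Metric.ball (0 : EuclideanSpace ℝ (Fin d)) 1)) := by
        rw [ENNReal.ofReal_mul (Real.exp_pos _).le, mul_assoc]
    _ ≤ ENNReal.ofReal (r ^ d) * volume G := by
        gcongr
        · exact exp_neg_two_mul_le_one_sub_div_pow ha0.le hd0 (by linarith)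
        · exact half_volume_unitBall_le_volume_slab hd0 ht hnorm
    _ = volume (r • G) := by
        rw [Measure.addHaar_smul, finrank_euclideanSpace_fin, abs_of_pos (pow_pos hr0 d)]
    _ ≤ _ := measure_mono hsub
    _ = _ := measure_preimage_add _ _ _
end

section
/- There exists a universal constant c_3 > 0 such that for every integer d ≥ 2 and all x, y ∈ ℝ^d, one has vol(B_1(x) ∩ B_1(y)) ≤ c_3^{−1} · exp(−c_3 d |x − y|_2^2) · vol(B_1(0)). -/
open MeasureTheory

/-- The intersection of two unit balls lies in a ball around the midpoint of their centers, of
radius at least `√(1 - dist x y ^ 2 / 4)`. -/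
lemma ball_inter_ball_subset_ball_midpoint {E : Type*} [NormedAddCommGroup E]
    [InnerProductSpace ℝ E] (x y : E) :
    Metric.ball x 1 ∩ Metric.ball y 1 ⊆
      Metric.ball (midpoint ℝ x y) (Real.exp (-(dist x y ^ 2 / 8))) := by
  rintro z ⟨hx, hy⟩
  rw [Metric.mem_ball, dist_eq_norm] at *
  have hpar := parallelogram_law_with_norm ℝ (z - x) (z - y)
  have hsub : ‖(z - x) - (z - y)‖ = dist x y := by
    rw [sub_sub_sub_cancel_left, dist_comm, dist_eq_norm]
  have hadd : (z - x) + (z - y) = (2 : ℝ) • (z - midpoint ℝ x y) := by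
    rw [midpoint_eq_smul_add]
    simp only [invOf_eq_inv]
    module
  rw [hsub, hadd, norm_smul, Real.norm_ofNat] at hpar
  have hexp : Real.exp (-(dist x y ^ 2 / 8)) ^ 2 = Real.exp (-(dist x y ^ 2 / 4)) := by
    rw [← Real.exp_nat_mul]
    congr 1
    push_cast
    ring
  have hle := Real.add_one_le_exp (-(dist x y ^ 2 / 4))
  refine lt_of_pow_lt_pow_left₀ 2 (Real.exp_pos _).le ?_
  rw [hexp]
  nlinarith [norm_nonneg (z - x), norm_nonneg (z - y)]

/-- There exists a universal constant `c₃ > 0` such that for every integer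
`d ≥ 2` and all `x, y ∈ ℝ^d`, one has
`vol(B₁(x) ∩ B₁(y)) ≤ c₃⁻¹ · exp(−c₃ d |x − y|₂²) · vol(B₁(0))`. -/
theorem ball_intersection_upper_bound :
    ∃ c₃ : ℝ, 0 < c₃ ∧ ∀ d : ℕ, 2 ≤ d →
      ∀ x y : EuclideanSpace ℝ (Fin d),
        volume (Metric.ball x 1 ∩ Metric.ball y 1) ≤
          ENNReal.ofReal (c₃⁻¹ * Real.exp (-c₃ * d * dist x y ^ 2)) *
            volume (Metric.ball (0 : EuclideanSpace ℝ (Fin d)) 1) := by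
  refine ⟨1 / 8, by norm_num, fun d _ x y => ?_⟩
  refine (measure_mono (ball_inter_ball_subset_ball_midpoint x y)).trans ?_
  rw [Measure.addHaar_ball_of_pos volume _ (Real.exp_pos _), finrank_euclideanSpace_fin,
    ← Real.exp_nat_mul]
  have hexp : (d : ℝ) * -(dist x y ^ 2 / 8) = -(1 / 8) * d * dist x y ^ 2 := by ring
  rw [hexp]
  gcongr
  exact le_mul_of_one_le_left (Real.exp_pos _).le (by norm_num)
end

section
/- There exists a universal constant C_1 > 0 such that the following holds. Let Z_1, Z_2 be independent standard Gaussian random variables on a probability space (Ω, ℙ), let a, b ∈ (0,1] and ρ ∈ [0,1], and set X := a Z_1 and Y := b(ρ Z_1 + √(1 − ρ^2) Z_2), so that (X,Y) is a centered jointly Gaussian pair with E[X^2] = a^2 ≤ 1, E[Y^2] = b^2 ≤ 1 and E[XY] = abρ ≥ 0. Then for every real t ≥ 1, ℙ[X ≥ t and Y ≥ t] ≤ exp(C_1 t^2 ρ/(ab)) · ℙ[X ≥ t] · ℙ[Y ≥ t]. (Note ρ/(ab) = E[XY]/(E[X^2] E[Y^2]).) -/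
open MeasureTheory ProbabilityTheory

/-- The upper tail `ℙ[Z ≥ u]` of a standard Gaussian variable, as an integral of its density. -/
noncomputable def gaussianTail (u : ℝ) : ℝ := ∫ x in Set.Ici u, gaussianPDFReal 0 1 x

theorem gaussianReal_Ici (u : ℝ) :
    gaussianReal 0 1 (Set.Ici u) = ENNReal.ofReal (gaussianTail u) :=
  gaussianReal_apply_eq_integral 0 one_ne_zero _

theorem gaussianTail_nonneg (u : ℝ) : 0 ≤ gaussianTail u :=
  setIntegral_nonneg measurableSet_Ici fun x _ => gaussianPDFReal_nonneg 0 1 x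

theorem continuous_gaussianPDFReal (m : ℝ) (v : NNReal) : Continuous (gaussianPDFReal m v) := by
  rw [gaussianPDFReal_def]
  fun_prop

theorem hasDerivAt_gaussianTail (u : ℝ) :
    HasDerivAt gaussianTail (-gaussianPDFReal 0 1 u) u := by
  have h : gaussianTail = fun v => gaussianTail 0 - ∫ x in (0 : ℝ)..v, gaussianPDFReal 0 1 x := by
    funext v
    rw [← intervalIntegral.integral_Ici_sub_Ici'
      (integrable_gaussianPDFReal 0 1).integrableOn (integrable_gaussianPDFReal 0 1).integrableOn]
    simp [gaussianTail]
  rw [h]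
  exact (intervalIntegral.integral_hasDerivAt_right
    ((continuous_gaussianPDFReal 0 1).intervalIntegrable _ _)
    (continuous_gaussianPDFReal 0 1).aestronglyMeasurable.stronglyMeasurableAtFilter
    (continuous_gaussianPDFReal 0 1).continuousAt).const_sub _

/-- The hazard rate of the standard Gaussian is at most `5 x` on `(-∞, x]` when `x ≥ 1`. -/
theorem gaussianPDFReal_le_mul_gaussianTail {u x : ℝ} (hx : 1 ≤ x) (hu : u ≤ x) :
    gaussianPDFReal 0 1 u ≤ 5 * x * gaussianTail u := by
  have hx0 : 0 < x := by linarith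
  have hpdf : ∀ v ∈ Set.Icc u (u + x⁻¹),
      gaussianPDFReal 0 1 u * (1 / 5) ≤ gaussianPDFReal 0 1 v := by
    rintro v ⟨huv, hvu⟩
    have hexp : Real.exp (3 / 2) ≤ 5 := by
      have h1 : Real.exp (3 / 2) ^ 2 = Real.exp 1 ^ 3 := by
        rw [← Real.exp_nat_mul, ← Real.exp_nat_mul]
        norm_num
      have h2 : Real.exp 1 ^ 3 ≤ 2.72 ^ 3 :=
        pow_le_pow_left₀ (Real.exp_pos 1).le (by linarith [Real.exp_one_lt_d9]) 3
      nlinarith [Real.exp_pos (3 / 2)]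
    have hexp' : 1 / 5 ≤ Real.exp (-(3 / 2)) := by
      rw [Real.exp_neg, one_div]
      exact inv_anti₀ (Real.exp_pos _) hexp
    have hinv : x⁻¹ * x = 1 := inv_mul_cancel₀ hx0.ne'
    have hinv_pos : 0 < x⁻¹ := inv_pos.mpr hx0
    have hinv1 : x⁻¹ ≤ 1 := inv_le_one_of_one_le₀ hx
    have hsq : v ^ 2 - u ^ 2 ≤ 3 := by
      have h1 : (v - u) * (v + u) ≤ (v - u) * (2 * x + x⁻¹) :=
        mul_le_mul_of_nonneg_left (by linarith) (by linarith)
      have h2 : (v - u) * (2 * x + x⁻¹) ≤ x⁻¹ * (2 * x + x⁻¹) :=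
        mul_le_mul_of_nonneg_right (by linarith) (by positivity)
      nlinarith
    simp only [gaussianPDFReal_def, NNReal.coe_one, mul_assoc]
    gcongr
    calc _ ≤ Real.exp (-(u - 0) ^ 2 / (2 * 1)) * Real.exp (-(3 / 2)) := by gcongr
      _ = Real.exp (-(u - 0) ^ 2 / (2 * 1) + -(3 / 2)) := (Real.exp_add _ _).symm
      _ ≤ _ := Real.exp_le_exp.mpr (by linarith)
  have hint : x⁻¹ * (gaussianPDFReal 0 1 u * (1 / 5)) ≤ gaussianTail u := by
    calc x⁻¹ * (gaussianPDFReal 0 1 u * (1 / 5))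
        = ∫ _ in Set.Icc u (u + x⁻¹), gaussianPDFReal 0 1 u * (1 / 5) := by
          simp [hx0.le]
      _ ≤ ∫ v in Set.Icc u (u + x⁻¹), gaussianPDFReal 0 1 v :=
          setIntegral_mono_on (integrableOn_const (by simp)) (integrable_gaussianPDFReal 0 1).integrableOn
            measurableSet_Icc hpdf
      _ ≤ gaussianTail u :=
          setIntegral_mono_set (integrable_gaussianPDFReal 0 1).integrableOn
            (ae_of_all _ (gaussianPDFReal_nonneg 0 1)) (ae_of_all _ Set.Icc_subset_Ici_self)
  rw [inv_mul_le_iff₀ hx0] at hint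
  linarith

theorem gaussianTail_sub_le {x s : ℝ} (hx : 1 ≤ x) (hs : 0 ≤ s) :
    gaussianTail (x - s) ≤ Real.exp (5 * x * s) * gaussianTail x := by
  have hderiv : ∀ u, HasDerivAt (fun u => Real.exp (5 * x * u) * gaussianTail u)
      (Real.exp (5 * x * u) * (5 * x * gaussianTail u - gaussianPDFReal 0 1 u)) u := by
    intro u
    have h := (((hasDerivAt_id u).const_mul (5 * x)).exp).mul (hasDerivAt_gaussianTail u)
    refine h.congr_deriv ?_
    simp only [id]
    ring
  have hmono : MonotoneOn (fun u => Real.exp (5 * x * u) * gaussianTail u) (Set.Iic x) := by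
    refine monotoneOn_of_deriv_nonneg (convex_Iic x)
      (fun u _ => (hderiv u).continuousAt.continuousWithinAt)
      (fun u _ => (hderiv u).differentiableAt.differentiableWithinAt) fun u hu => ?_
    rw [interior_Iic] at hu
    rw [(hderiv u).deriv]
    exact mul_nonneg (Real.exp_pos _).le
      (sub_nonneg.mpr (gaussianPDFReal_le_mul_gaussianTail hx hu.le))
  have h := hmono (show x - s ∈ Set.Iic x by simpa using hs) (Set.self_mem_Iic) (by linarith)
  simp only at h
  rw [show 5 * x * x = 5 * x * (x - s) + 5 * x * s by ring, Real.exp_add,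
    mul_assoc (Real.exp _)] at h
  exact le_of_mul_le_mul_left h (Real.exp_pos _)

theorem one_le_two_mul_gaussianTail_zero : 1 ≤ 2 * gaussianTail 0 := by
  have hsymm : gaussianReal 0 1 (Set.Iic 0) = gaussianReal 0 1 (Set.Ici 0) := by
    have h : (gaussianReal 0 1).map (fun x => -x) = gaussianReal 0 1 := by
      simpa using gaussianReal_map_neg (μ := 0) (v := 1)
    conv_lhs => rw [← h, Measure.map_apply measurable_neg measurableSet_Iic]
    simp
  have h : (1 : ENNReal) ≤ gaussianReal 0 1 (Set.Iic 0) + gaussianReal 0 1 (Set.Ici 0) := by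
    rw [← measure_univ (μ := gaussianReal 0 1), ← Set.Iic_union_Ici (a := (0 : ℝ))]
    exact measure_union_le _ _
  rw [hsymm, gaussianReal_Ici, ← ENNReal.ofReal_add (gaussianTail_nonneg 0)
    (gaussianTail_nonneg 0), ENNReal.one_le_ofReal] at h
  linarith

theorem one_le_exp_mul_gaussianTail {x : ℝ} (hx : 1 ≤ x) :
    1 ≤ Real.exp (6 * x ^ 2) * gaussianTail x := by
  have h1 := gaussianTail_sub_le hx (by linarith : 0 ≤ x)
  rw [sub_self] at h1
  have h2 : 2 ≤ Real.exp (x ^ 2) := by nlinarith [Real.add_one_le_exp (x ^ 2)]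
  calc 1 ≤ 2 * gaussianTail 0 := one_le_two_mul_gaussianTail_zero
    _ ≤ Real.exp (x ^ 2) * (Real.exp (5 * x * x) * gaussianTail x) := by
      have := gaussianTail_nonneg 0
      gcongr
    _ = _ := by
      rw [← mul_assoc, ← Real.exp_add]
      ring_nf

/-- Exponential tilting of the standard Gaussian restricted to a half-line. -/
theorem setLIntegral_exp_gaussianReal (c u : ℝ) :
    ∫⁻ z in Set.Ici u, ENNReal.ofReal (Real.exp (c * z)) ∂(gaussianReal 0 1) =
      ENNReal.ofReal (Real.exp (c ^ 2 / 2) * gaussianTail (u - c)) := by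
  have hpdf : ∀ z, gaussianPDF 0 1 z * ENNReal.ofReal (Real.exp (c * z)) =
      ENNReal.ofReal (Real.exp (c ^ 2 / 2)) * gaussianPDF c 1 z := by
    intro z
    simp only [gaussianPDF]
    rw [← ENNReal.ofReal_mul (gaussianPDFReal_nonneg _ _ _),
      ← ENNReal.ofReal_mul (Real.exp_pos _).le]
    congr 1
    simp only [gaussianPDFReal_def]
    rw [mul_assoc, mul_left_comm (Real.exp _), ← Real.exp_add, ← Real.exp_add]
    congr 2
    simp only [NNReal.coe_one]
    ring
  have hshift : gaussianReal c 1 (Set.Ici u) = ENNReal.ofReal (gaussianTail (u - c)) := by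
    have h : (gaussianReal 0 1).map (· + c) = gaussianReal c 1 := by
      simpa using gaussianReal_map_add_const (μ := 0) (v := 1) c
    rw [← h, Measure.map_apply (by fun_prop) measurableSet_Ici, Set.preimage_add_const_Ici,
      gaussianReal_Ici]
  rw [gaussianReal_of_var_ne_zero 0 one_ne_zero,
    setLIntegral_withDensity_eq_setLIntegral_mul _ (measurable_gaussianPDF 0 1) (by fun_prop)
      measurableSet_Ici]
  simp only [Pi.mul_apply, hpdf]
  rw [lintegral_const_mul _ (measurable_gaussianPDF c 1), ← gaussianReal_apply c one_ne_zero,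
    hshift, ENNReal.ofReal_mul (Real.exp_pos _).le]

/-- Conditionally on `Z₁ = z`, the tail of `ρ Z₁ + r Z₂` exceeds that of a standard Gaussian by at
most an exponential factor. -/
theorem gaussianReal_section_le {β ρ r z : ℝ} (hβ : 1 ≤ β) (hρ : 0 ≤ ρ) (hr : 0 ≤ r)
    (hr1 : r ≤ 1) (hz : 0 ≤ z) :
    gaussianReal 0 1 {w | β ≤ ρ * z + r * w} ≤
      ENNReal.ofReal (Real.exp (6 * β * ρ * z) * gaussianTail β) := by
  have hρz : 0 ≤ ρ * z := mul_nonneg hρ hz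
  rcases lt_or_ge (ρ * z) β with h | h
  · have hsub : {w | β ≤ ρ * z + r * w} ⊆ Set.Ici (β - ρ * z) := by
      intro w hw
      simp only [Set.mem_ofPred_eq, Set.mem_Ici] at hw ⊢
      have hw0 : 0 < w := by
        by_contra! hneg
        nlinarith
      nlinarith
    refine (measure_mono hsub).trans ?_
    rw [gaussianReal_Ici]
    refine ENNReal.ofReal_le_ofReal ((gaussianTail_sub_le hβ hρz).trans ?_)
    refine mul_le_mul_of_nonneg_right (Real.exp_le_exp.mpr ?_) (gaussianTail_nonneg β)
    nlinarith [mul_nonneg (zero_le_one.trans hβ) hρz]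
  · refine prob_le_one.trans ?_
    rw [ENNReal.one_le_ofReal]
    refine (one_le_exp_mul_gaussianTail hβ).trans ?_
    refine mul_le_mul_of_nonneg_right (Real.exp_le_exp.mpr ?_) (gaussianTail_nonneg β)
    nlinarith

theorem prod_gaussianReal_quadrant_le {α β ρ r : ℝ} (hα : 1 ≤ α) (hβ : 1 ≤ β) (hρ : 0 ≤ ρ)
    (hr : 0 ≤ r) (hr1 : r ≤ 1) (hαβ : ρ * β ≤ α) :
    (gaussianReal 0 1).prod (gaussianReal 0 1) {p : ℝ × ℝ | α ≤ p.1 ∧ β ≤ ρ * p.1 + r * p.2} ≤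
      ENNReal.ofReal (Real.exp (48 * (α * β * ρ)) * gaussianTail α * gaussianTail β) := by
  have hmeas : MeasurableSet {p : ℝ × ℝ | α ≤ p.1 ∧ β ≤ ρ * p.1 + r * p.2} :=
    (measurableSet_le measurable_const measurable_fst).inter
      (measurableSet_le (g := fun p : ℝ × ℝ => ρ * p.1 + r * p.2) measurable_const (by fun_prop))
  have hβρ : 0 ≤ β * ρ := mul_nonneg (by linarith) hρ
  rw [Measure.prod_apply hmeas]
  calc _ ≤ ∫⁻ z, (Set.Ici α).indicator (fun z => ENNReal.ofReal (gaussianTail β) *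
            ENNReal.ofReal (Real.exp (6 * β * ρ * z))) z ∂(gaussianReal 0 1) := by
        refine lintegral_mono fun z => ?_
        by_cases hz : α ≤ z
        · rw [Set.indicator_of_mem (Set.mem_Ici.mpr hz),
            ← ENNReal.ofReal_mul (gaussianTail_nonneg β), mul_comm (gaussianTail β)]
          simpa [hz] using gaussianReal_section_le hβ hρ hr hr1 (by linarith : 0 ≤ z)
        · simp [hz]
    _ = ENNReal.ofReal (gaussianTail β * (Real.exp ((6 * β * ρ) ^ 2 / 2) *
          gaussianTail (α - 6 * β * ρ))) := by
        rw [lintegral_indicator measurableSet_Ici, lintegral_const_mul _ (by fun_prop),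
          setLIntegral_exp_gaussianReal, ENNReal.ofReal_mul (gaussianTail_nonneg β)]
    _ ≤ _ := by
        refine ENNReal.ofReal_le_ofReal ?_
        have h := gaussianTail_sub_le hα (by linarith : 0 ≤ 6 * β * ρ)
        have hα0 := gaussianTail_nonneg α
        have hβ0 := gaussianTail_nonneg β
        calc _ ≤ gaussianTail β * (Real.exp ((6 * β * ρ) ^ 2 / 2) *
              (Real.exp (5 * α * (6 * β * ρ)) * gaussianTail α)) := by gcongr
          _ = Real.exp ((6 * β * ρ) ^ 2 / 2 + 5 * α * (6 * β * ρ)) * gaussianTail α *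
              gaussianTail β := by rw [Real.exp_add]; ring
          _ ≤ _ := by
            gcongr
            nlinarith [mul_le_mul_of_nonneg_left hαβ hβρ]

theorem map_correlated_gaussian {Ω : Type*} {mΩ : MeasurableSpace Ω} {P : Measure Ω}
    {Z₁ Z₂ : Ω → ℝ} (hindep : IndepFun Z₁ Z₂ P)
    (h₁ : HasLaw Z₁ (gaussianReal 0 1) P) (h₂ : HasLaw Z₂ (gaussianReal 0 1) P)
    {ρ : ℝ} (hρ : 0 ≤ ρ) (hρ1 : ρ ≤ 1) :
    P.map (fun ω => ρ * Z₁ ω + Real.sqrt (1 - ρ ^ 2) * Z₂ ω) = gaussianReal 0 1 := by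
  have hind : IndepFun (fun ω => ρ * Z₁ ω) (fun ω => Real.sqrt (1 - ρ ^ 2) * Z₂ ω) P :=
    hindep.comp (φ := fun x => ρ * x) (ψ := fun x => Real.sqrt (1 - ρ ^ 2) * x)
      (by fun_prop) (by fun_prop)
  have h := gaussianReal_add_gaussianReal_of_indepFun hind
    (gaussianReal_const_mul h₁ ρ).map_eq
    (gaussianReal_const_mul h₂ (Real.sqrt (1 - ρ ^ 2))).map_eq
  change P.map ((fun ω => ρ * Z₁ ω) + fun ω => Real.sqrt (1 - ρ ^ 2) * Z₂ ω) = _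
  rw [h]
  congr 1
  · simp
  · ext
    have : 0 ≤ 1 - ρ ^ 2 := by nlinarith
    simp [Real.sq_sqrt this]

/-- There exists a universal constant `C₁ > 0` such that the following holds.
Let `Z₁, Z₂` be independent standard Gaussians, let `a, b ∈ (0,1]` and `ρ ∈ [0,1]`, and set
`X = a Z₁`, `Y = b(ρ Z₁ + √(1−ρ²) Z₂)`. Then for every `t ≥ 1`,
`ℙ[X ≥ t, Y ≥ t] ≤ exp(C₁ t² ρ/(ab)) · ℙ[X ≥ t] · ℙ[Y ≥ t]`. -/
theorem gaussian_correlation_inequality :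
    ∃ C₁ : ℝ, 0 < C₁ ∧
      ∀ (Ω : Type) (_ : MeasurableSpace Ω) (P : Measure Ω), IsProbabilityMeasure P →
      ∀ Z₁ Z₂ : Ω → ℝ, Measurable Z₁ → Measurable Z₂ → IndepFun Z₁ Z₂ P →
        P.map Z₁ = gaussianReal 0 1 → P.map Z₂ = gaussianReal 0 1 →
      ∀ a b ρ : ℝ, 0 < a → a ≤ 1 → 0 < b → b ≤ 1 → 0 ≤ ρ → ρ ≤ 1 →
      ∀ t : ℝ, 1 ≤ t →
        P {ω | t ≤ a * Z₁ ω ∧ t ≤ b * (ρ * Z₁ ω + Real.sqrt (1 - ρ ^ 2) * Z₂ ω)} ≤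
          ENNReal.ofReal (Real.exp (C₁ * t ^ 2 * ρ / (a * b))) *
            P {ω | t ≤ a * Z₁ ω} *
            P {ω | t ≤ b * (ρ * Z₁ ω + Real.sqrt (1 - ρ ^ 2) * Z₂ ω)} := by
  refine ⟨48, by norm_num, ?_⟩
  intro Ω _ P hP Z₁ Z₂ hm₁ hm₂ hindep hlaw₁ hlaw₂ a b ρ ha ha1 hb hb1 hρ hρ1 t ht
  set r := Real.sqrt (1 - ρ ^ 2) with hr_def
  have hr1 : r ≤ 1 := Real.sqrt_le_one.mpr (by nlinarith)
  have hα : 1 ≤ t / a := (one_le_div ha).mpr (by linarith)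
  have hβ : 1 ≤ t / b := (one_le_div hb).mpr (by linarith)
  have hY := map_correlated_gaussian hindep ⟨hm₁.aemeasurable, hlaw₁⟩ ⟨hm₂.aemeasurable, hlaw₂⟩
    hρ hρ1
  rw [← hr_def] at hY
  have hPX : P {ω | t ≤ a * Z₁ ω} = ENNReal.ofReal (gaussianTail (t / a)) := by
    rw [← gaussianReal_Ici, ← hlaw₁, Measure.map_apply hm₁ measurableSet_Ici]
    congr 1
    ext ω
    simp [div_le_iff₀' ha]
  have hPY : P {ω | t ≤ b * (ρ * Z₁ ω + r * Z₂ ω)} = ENNReal.ofReal (gaussianTail (t / b)) := by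
    rw [← gaussianReal_Ici, ← hY, Measure.map_apply (by fun_prop) measurableSet_Ici]
    congr 1
    ext ω
    simp [div_le_iff₀' hb]
  have hexponent : 48 * t ^ 2 * ρ / (a * b) = 48 * (t / a * (t / b) * ρ) := by
    field_simp
  have hα0 := gaussianTail_nonneg (t / a)
  have hβ0 := gaussianTail_nonneg (t / b)
  rw [hexponent, hPX, hPY, ← ENNReal.ofReal_mul (Real.exp_pos _).le,
    ← ENNReal.ofReal_mul (by positivity)]
  rcases le_total (ρ * (t / b)) (t / a) with h | h
  · have hjoint := prod_gaussianReal_quadrant_le hα hβ hρ (Real.sqrt_nonneg (1 - ρ ^ 2)) hr1 h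
    have hmeas : MeasurableSet {p : ℝ × ℝ | t / a ≤ p.1 ∧ t / b ≤ ρ * p.1 + r * p.2} :=
      (measurableSet_le measurable_const measurable_fst).inter
        (measurableSet_le (g := fun p : ℝ × ℝ => ρ * p.1 + r * p.2) measurable_const
          (by fun_prop))
    have hprod := hindep.map_prod_eq_prod_map_map hm₁.aemeasurable hm₂.aemeasurable
    rw [hlaw₁, hlaw₂] at hprod
    rw [← hr_def, ← hprod, Measure.map_apply (by fun_prop) hmeas] at hjoint
    simpa [div_le_iff₀' ha, div_le_iff₀' hb] using hjoint
  · calc _ ≤ P {ω | t ≤ b * (ρ * Z₁ ω + r * Z₂ ω)} := measure_mono fun ω hω => hω.2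
      _ = ENNReal.ofReal (gaussianTail (t / b)) := hPY
      _ ≤ _ := by
        refine ENNReal.ofReal_le_ofReal (le_mul_of_one_le_left hβ0 ?_)
        refine (one_le_exp_mul_gaussianTail hα).trans ?_
        refine mul_le_mul_of_nonneg_right (Real.exp_le_exp.mpr ?_) hα0
        have hmul : 0 ≤ t / a * (t / b) * ρ := by positivity
        have h1 : t / a * (t / a) ≤ t / a * (ρ * (t / b)) := by gcongr
        nlinarith
end

section
/- Fix reals θ > 0 and δ > 0. For v > 0 let Φ̄_v(s) := ℙ[N(0,v) ≥ s] denote the upper tail of the centered Gaussian distribution of variance v. Then for every ε > 0 there exists M > 0 such that for all real m ≥ M: sup over σ^2 ∈ [δ, 1] and real t ≤ δ^{−1} of the ratio [ exp(−t^2/(2σ^2)) · Φ̄_{mσ^2}((m+1)σ^2 θ − t) ] / [ Φ̄_{(m+1)σ^2}((m+1)σ^2 θ) · exp(−(t − σ^2 θ)^2/(2σ^2)) ] is at most 1 + ε. (Equivalently: if X ~ N(0, σ^2) and Y ~ N(0, mσ^2) are independent, then the conditional density of X at t given X + Y ≥ (m+1)σ^2 θ is at most (1 + o_m(1)) times the density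 of N(σ^2 θ, σ^2) at t, uniformly over δ ≤ σ^2 ≤ 1 and t ≤ δ^{−1}.) -/
open MeasureTheory ProbabilityTheory

/-- The upper tail `ℙ[N(0,v) ≥ s]` of the centered Gaussian distribution of variance `v`,
as a real number. -/
noncomputable def gaussianUpperTail (v s : ℝ) : ℝ :=
  ((gaussianReal 0 (Real.toNNReal v)) (Set.Ici s)).toReal

open Filter Topology

lemma gaussianUpperTail_eq_integral {v : ℝ} (hv : 0 < v) (a : ℝ) :
    gaussianUpperTail v a =
      (√(2 * Real.pi * v))⁻¹ * ∫ x in Set.Ioi a, Real.exp (-x ^ 2 / (2 * v)) := by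
  have hv' : v.toNNReal ≠ 0 := by simpa using hv
  have h : gaussianPDFReal 0 v.toNNReal =
      fun x ↦ (√(2 * Real.pi * v))⁻¹ * Real.exp (-x ^ 2 / (2 * v)) := by
    ext x
    simp [gaussianPDFReal, Real.coe_toNNReal _ hv.le]
  rw [gaussianUpperTail, gaussianReal_apply_eq_integral _ hv', ENNReal.toReal_ofReal
    (integral_nonneg fun x ↦ gaussianPDFReal_nonneg _ _ x), integral_Ici_eq_integral_Ioi, h,
    integral_const_mul]

lemma integrable_exp_neg_sq_div {v : ℝ} (hv : 0 < v) :
    Integrable fun x : ℝ ↦ Real.exp (-x ^ 2 / (2 * v)) := by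
  refine (integrable_exp_neg_mul_sq (b := 1 / (2 * v)) (by positivity)).congr ?_
  filter_upwards with x
  congr 1
  ring

/-- The Chernoff-type upper bound on a Gaussian tail obtained from exponential tilting by `θ`. -/
lemma gaussianUpperTail_le {v θ : ℝ} (hv : 0 < v) (hθ : 0 < θ) (a : ℝ) :
    gaussianUpperTail v a ≤
      (√(2 * Real.pi * v))⁻¹ * (Real.exp (v * θ ^ 2 / 2 - θ * a) / θ) := by
  rw [gaussianUpperTail_eq_integral hv]
  refine mul_le_mul_of_nonneg_left ?_ (by positivity)
  have hneg : -θ < 0 := neg_neg_of_pos hθ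
  calc ∫ x in Set.Ioi a, Real.exp (-x ^ 2 / (2 * v))
      ≤ ∫ x in Set.Ioi a, Real.exp (v * θ ^ 2 / 2) * Real.exp (-θ * x) := by
        refine integral_mono (integrable_exp_neg_sq_div hv).integrableOn
          ((integrableOn_exp_mul_Ioi hneg a).const_mul _) fun x ↦ ?_
        rw [← Real.exp_add, Real.exp_le_exp, div_le_iff₀ (by positivity)]
        nlinarith [sq_nonneg (x - v * θ)]
    _ = Real.exp (v * θ ^ 2 / 2 - θ * a) / θ := by
        rw [integral_const_mul, integral_exp_mul_Ioi hneg, neg_div_neg_eq, ← mul_div_assoc,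
          ← Real.exp_add]
        congr 2
        ring

/-- The lower bound on a Gaussian tail from the Mills ratio. -/
lemma le_gaussianUpperTail {v a : ℝ} (hv : 0 < v) (ha : 0 < a) :
    (√(2 * Real.pi * v))⁻¹ * (v / a * Real.exp (-a ^ 2 / (2 * v))) ≤
      (1 + v / a ^ 2) * gaussianUpperTail v a := by
  rw [gaussianUpperTail_eq_integral hv, mul_left_comm (1 + v / a ^ 2)]
  refine mul_le_mul_of_nonneg_left ?_ (by positivity)
  set G : ℝ → ℝ := fun x ↦ -(v / x * Real.exp (-x ^ 2 / (2 * v)))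
  set G' : ℝ → ℝ := fun x ↦ (1 + v / x ^ 2) * Real.exp (-x ^ 2 / (2 * v))
  have hderiv : ∀ x ∈ Set.Ici a, HasDerivAt G (G' x) x := by
    intro x hx
    have hx0 : x ≠ 0 := (ha.trans_le hx).ne'
    have h1 : HasDerivAt (fun x : ℝ ↦ v / x) (-v / x ^ 2) x := by
      simpa [div_eq_mul_inv] using (hasDerivAt_inv hx0).const_mul v
    have h2 : HasDerivAt (fun x : ℝ ↦ Real.exp (-x ^ 2 / (2 * v)))
        (Real.exp (-x ^ 2 / (2 * v)) * (-(2 * x) / (2 * v))) x := by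
      simpa using (((hasDerivAt_pow 2 x).neg).div_const (2 * v)).exp
    refine (h1.mul h2).neg.congr_deriv ?_
    simp only [G']
    field_simp
    ring
  have hpos : ∀ x ∈ Set.Ioi a, 0 ≤ G' x := fun x _ ↦ by positivity
  have hlim : Tendsto G atTop (𝓝 0) := by
    have h0 : Tendsto (fun x : ℝ ↦ v / x) atTop (𝓝 0) := tendsto_const_nhds.div_atTop tendsto_id
    rw [← neg_zero]
    refine (squeeze_zero' ?_ ?_ h0).neg
    · filter_upwards [eventually_gt_atTop 0] with x hx
      positivity
    · filter_upwards [eventually_gt_atTop 0] with x hx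
      refine mul_le_of_le_one_right (by positivity) (Real.exp_le_one_iff.2 ?_)
      exact div_nonpos_of_nonpos_of_nonneg (by nlinarith [sq_nonneg x]) (by positivity)
  have hFTC := integral_Ioi_of_hasDerivAt_of_nonneg' hderiv hpos hlim
  have hint := integrableOn_Ioi_deriv_of_nonneg' hderiv hpos hlim
  calc v / a * Real.exp (-a ^ 2 / (2 * v)) = ∫ x in Set.Ioi a, G' x := by
        rw [hFTC]
        simp [G]
    _ ≤ ∫ x in Set.Ioi a, (1 + v / a ^ 2) * Real.exp (-x ^ 2 / (2 * v)) := by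
        refine setIntegral_mono_on hint
          ((integrable_exp_neg_sq_div hv).integrableOn.const_mul _) measurableSet_Ioi
          fun x hx ↦ ?_
        have hx : a < x := hx
        simp only [G']
        gcongr
    _ = _ := integral_const_mul _ _

/-- Fix `θ > 0` and `δ > 0`. For every `ε > 0` there exists `M > 0` such that
for all `m ≥ M`, uniformly over `σ² ∈ [δ, 1]` and `t ≤ δ⁻¹`, the ratio
`[exp(−t²/(2σ²)) Φ̄_{mσ²}((m+1)σ²θ − t)] / [Φ̄_{(m+1)σ²}((m+1)σ²θ) exp(−(t−σ²θ)²/(2σ²))]`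
is at most `1 + ε` (stated in product form, avoiding division). -/
theorem gaussian_entropic_repulsion (θ δ : ℝ) (hθ : 0 < θ) (hδ : 0 < δ) :
    ∀ ε : ℝ, 0 < ε → ∃ M : ℝ, 0 < M ∧ ∀ m : ℝ, M ≤ m →
      ∀ σsq : ℝ, δ ≤ σsq → σsq ≤ 1 → ∀ t : ℝ, t ≤ δ⁻¹ →
        Real.exp (-t ^ 2 / (2 * σsq)) *
            gaussianUpperTail (m * σsq) ((m + 1) * σsq * θ - t) ≤
          (1 + ε) * gaussianUpperTail ((m + 1) * σsq) ((m + 1) * σsq * θ) *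
            Real.exp (-(t - σsq * θ) ^ 2 / (2 * σsq)) := by
  intro ε hε
  have hlim : Tendsto (fun m : ℝ ↦ (1 + 1 / m) * (1 + 1 / (δ * θ ^ 2) / m)) atTop (𝓝 1) := by
    have h (c : ℝ) : Tendsto (fun m : ℝ ↦ 1 + c / m) atTop (𝓝 1) := by
      simpa using (tendsto_const_nhds (x := (1 : ℝ))).add
        ((tendsto_const_nhds (x := c)).div_atTop tendsto_id)
    simpa only [one_mul] using (h 1).mul (h (1 / (δ * θ ^ 2)))
  obtain ⟨M, hM⟩ := eventually_atTop.1 (hlim.eventually_le_const (lt_add_of_pos_right 1 hε))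
  refine ⟨max M 1, by positivity, fun m hm s hs _ t _ ↦ ?_⟩
  have hm0 : 0 < m := by linarith [le_max_right M 1]
  have hs0 : 0 < s := hδ.trans_le hs
  set w := (m + 1) * s with hw
  have hw0 : 0 < w := by positivity
  set c := (√(2 * Real.pi * w))⁻¹ with hc
  have hupper := gaussianUpperTail_le (v := m * s) (by positivity) hθ (w * θ - t)
  have hlower := le_gaussianUpperTail hw0 (mul_pos hw0 hθ)
  have hsqrt : (√(2 * Real.pi * (m * s)))⁻¹ ≤ (1 + 1 / m) * c := by
    have h1 : √(2 * Real.pi * w) ≤ (1 + 1 / m) * √(2 * Real.pi * (m * s)) := by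
      refine (Real.sqrt_le_left (by positivity)).2 ?_
      rw [mul_pow, Real.sq_sqrt (by positivity)]
      have : 2 * Real.pi * w = (1 + 1 / m) * (2 * Real.pi * (m * s)) := by
        rw [hw]
        field_simp
      rw [this]
      gcongr
      exact le_self_pow₀ (by simp [hm0.le]) two_ne_zero
    rw [hc, ← div_eq_mul_inv, le_div_iff₀ (by positivity), ← div_eq_inv_mul,
      div_le_iff₀ (by positivity)]
    exact h1
  have hmills : 1 + w / (w * θ) ^ 2 ≤ 1 + 1 / (δ * θ ^ 2) / m := by
    have : w / (w * θ) ^ 2 = 1 / (w * θ ^ 2) := by field_simp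
    have hle : δ * θ ^ 2 * m ≤ w * θ ^ 2 := by
      nlinarith [mul_le_mul_of_nonneg_left hs hm0.le, sq_nonneg θ]
    rw [this, div_div]
    gcongr 1 + 1 / ?_
  set T := gaussianUpperTail w (w * θ) with hT
  have hT0 : 0 ≤ T := ENNReal.toReal_nonneg
  set E := Real.exp (-(t - s * θ) ^ 2 / (2 * s)) with hE
  calc Real.exp (-t ^ 2 / (2 * s)) * gaussianUpperTail (m * s) (w * θ - t)
      ≤ Real.exp (-t ^ 2 / (2 * s)) *
          ((1 + 1 / m) * c * (Real.exp (m * s * θ ^ 2 / 2 - θ * (w * θ - t)) / θ)) := by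
        gcongr
        exact hupper.trans (by gcongr)
    _ = (1 + 1 / m) * (c * (w / (w * θ) * Real.exp (-(w * θ) ^ 2 / (2 * w)))) * E := by
        have hexp : Real.exp (-t ^ 2 / (2 * s)) *
            Real.exp (m * s * θ ^ 2 / 2 - θ * (w * θ - t)) =
            Real.exp (-(w * θ) ^ 2 / (2 * w)) * E := by
          rw [hE, ← Real.exp_add, ← Real.exp_add]
          congr 1
          have : -(w * θ) ^ 2 / (2 * w) = -(w * θ ^ 2) / 2 := by field_simp
          rw [this, hw]
          field_simp
          ring
        have hdiv : w / (w * θ) = 1 / θ := by field_simp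
        rw [hdiv]
        linear_combination (1 + 1 / m) * c / θ * hexp
    _ ≤ (1 + 1 / m) * ((1 + 1 / (δ * θ ^ 2) / m) * T) * E := by
        refine mul_le_mul_of_nonneg_right (mul_le_mul_of_nonneg_left ?_ (by positivity))
          (Real.exp_nonneg _)
        exact hlower.trans (mul_le_mul_of_nonneg_right hmills hT0)
    _ ≤ (1 + ε) * T * E := by
        rw [← mul_assoc]
        gcongr
        exact hM m ((le_max_left _ _).trans hm)
end

section
/- Let V be a countable set, let G be a simple graph on V in which every vertex has degree at most Δ for some integer Δ ≥ 1, and let p ∈ (0,1). Let μ be a probability measure on configurations η ∈ {0,1}^V (with the product σ-algebra) such that: (1) μ[η(s) = 1] ≥ p for every s ∈ V; and (2) for every pair of disjoint subsets S_1, S_2 ⊆ V with no edge of G joining a vertex of S_1 to a vertex of S_2, any event depending only on the coordinates in S_1 is independent (under μ) of any event depending only on the coordinates in S_2. Let θ ∈ (0,1) satisfy (1 − θ)θ^Δ ≥ 1 − p. Then for every x ∈ V and every finite S ⊆ V with x ∉ S, μ[η(x) = 1 and η(s) = 1 for all s ∈ S] ≥ θ · μ[η(s) = 1 for all s ∈ S].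 -/
open MeasureTheory ProbabilityTheory

/-- If adjoining a point to a set of fewer than `n` points costs at most a factor `θ`, then
adjoining `T` to `M` costs at most `θ ^ #T`, as long as `M ∪ T` has at most `n` points. -/
theorem pow_card_mul_le_of_insert {V : Type*} [DecidableEq V] (g : Finset V → ℝ) {θ : ℝ}
    (hθ : 0 ≤ θ) {n : ℕ}
    (hg : ∀ y U, y ∉ U → U.card < n → θ * g U ≤ g (insert y U)) (M T : Finset V)
    (hd : Disjoint M T) (hn : (M ∪ T).card ≤ n) : θ ^ T.card * g M ≤ g (M ∪ T) := by
  induction T using Finset.induction_on with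
  | empty => simp
  | insert y T hy ih =>
    rw [Finset.disjoint_insert_right] at hd
    have hyU : y ∉ M ∪ T := by simp [hd.1, hy]
    rw [Finset.union_insert] at hn ⊢
    rw [Finset.card_insert_of_notMem hyU] at hn
    rw [Finset.card_insert_of_notMem hy]
    calc θ ^ (T.card + 1) * g M = θ * (θ ^ T.card * g M) := by ring
      _ ≤ θ * g (M ∪ T) := mul_le_mul_of_nonneg_left (ih hd.2 (by lia)) hθ
      _ ≤ g (insert y (M ∪ T)) := hg y _ hyU (by lia)

/-- The event that all coordinates in `M` are `true` is determined by any set containing `M`. -/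
theorem measurableSet_comap_restrict_forall_eq_true {V : Type*} (M : Finset V) {A : Set V}
    (hA : ↑M ⊆ A) :
    MeasurableSet[MeasurableSpace.comap (fun (η : V → Bool) (s : A) => η s.1) inferInstance]
      {η : V → Bool | ∀ s ∈ M, η s = true} := by
  refine ⟨⋂ s : M, (fun ω : A → Bool => ω ⟨s, hA s.2⟩) ⁻¹' {true}, ?_, ?_⟩
  · exact MeasurableSet.iInter fun s =>
      measurable_pi_apply (⟨s, hA s.2⟩ : A) (measurableSet_singleton true)
  · ext η
    simp

/-- Liggett-type domination lemma: Let `V` be countable, `G` a simple graph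
on `V` of maximum degree at most `Δ`, and `μ` a probability measure on `{0,1}^V` such that
each coordinate equals `1` with probability at least `p`, and the restrictions to two
non-neighboring sets of vertices are independent. If `θ ∈ (0,1)` satisfies
`(1 − θ)θ^Δ ≥ 1 − p`, then for all `x ∉ S` (with `S` finite),
`μ[η(x) = 1 and η ≡ 1 on S] ≥ θ · μ[η ≡ 1 on S]`. -/
theorem liggett_domination (V : Type*) [Countable V] (G : SimpleGraph V) (Δ : ℕ)
    (hΔ : 1 ≤ Δ)
    (hdeg : ∀ v : V, (G.neighborSet v).Finite ∧ (G.neighborSet v).ncard ≤ Δ)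
    (μ : Measure (V → Bool)) [IsProbabilityMeasure μ]
    (p : ℝ) (hp : 0 < p) (hp1 : p < 1)
    (hmarg : ∀ s : V, ENNReal.ofReal p ≤ μ {η | η s = true})
    (hindep : ∀ S₁ S₂ : Set V, Disjoint S₁ S₂ →
      (∀ a ∈ S₁, ∀ b ∈ S₂, ¬ G.Adj a b) →
      ProbabilityTheory.Indep
        (MeasurableSpace.comap (fun (η : V → Bool) (s : S₁) => η s.1) inferInstance)
        (MeasurableSpace.comap (fun (η : V → Bool) (s : S₂) => η s.1) inferInstance) μ)
    (θ : ℝ) (hθ0 : 0 < θ) (hθ1 : θ < 1) (hθp : 1 - p ≤ (1 - θ) * θ ^ Δ) :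
    ∀ x : V, ∀ S : Finset V, x ∉ S →
      ENNReal.ofReal θ * μ {η | ∀ s ∈ S, η s = true} ≤
        μ {η | η x = true ∧ ∀ s ∈ S, η s = true} := by
  classical
  set g : Finset V → ℝ := fun S => μ.real {η | ∀ s ∈ S, η s = true} with hg
  have meas (S : Finset V) : MeasurableSet {η : V → Bool | ∀ s ∈ S, η s = true} :=
    (measurable_pi_lambda _ fun s => measurable_pi_apply s.1 :
      Measurable fun (η : V → Bool) (s : (S : Set V)) => η s.1).comap_le _
      (measurableSet_comap_restrict_forall_eq_true S subset_rfl)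
  have g_single (x : V) : p ≤ g {x} := by
    have h := hmarg x
    rw [ENNReal.ofReal_le_iff_le_toReal (measure_ne_top _ _)] at h
    simpa [hg, Measure.real] using h
  have g_insert (x : V) (M : Finset V) (hx : x ∉ M) (hM : ∀ s ∈ M, ¬ G.Adj x s) :
      g (insert x M) = g {x} * g M := by
    have h := (Indep_iff _ _ _).mp (hindep {x} M (by simpa using hx) (by simpa using hM)) _ _
      (measurableSet_comap_restrict_forall_eq_true {x} (by simp))
      (measurableSet_comap_restrict_forall_eq_true M subset_rfl)
    simp only [hg, Measure.real, ← ENNReal.toReal_mul, ← h]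
    congr 2
    ext η
    simp
  have g_closed (x : V) (S : Finset V) :
      g S - g (insert x S) = μ.real {η | η x = false ∧ ∀ s ∈ S, η s = true} := by
    have hsub : {η : V → Bool | ∀ s ∈ insert x S, η s = true} ⊆ {η | ∀ s ∈ S, η s = true} :=
      fun η h s hs => h s (Finset.mem_insert_of_mem hs)
    rw [← measureReal_sdiff hsub (meas _)]
    congr 1
    ext η
    simp only [Set.mem_sdiff, Set.mem_ofPred_eq, Finset.forall_mem_insert]
    cases η x <;> simp
  have key (n : ℕ) : ∀ x (S : Finset V), x ∉ S → S.card < n → θ * g S ≤ g (insert x S) := by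
    induction n with
    | zero => simp
    | succ n ih =>
      intro x S hx hS
      set N := S.filter (G.Adj x)
      set M := S.filter (fun s => ¬ G.Adj x s)
      have hMN : M ∪ N = S := by rw [Finset.union_comm, Finset.filter_union_filter_not_eq]
      have hN : N.card ≤ Δ := by
        refine le_trans ?_ (hdeg x).2
        rw [← Set.ncard_coe_finset]
        exact Set.ncard_le_ncard (fun s hs => (Finset.mem_filter.mp hs).2) (hdeg x).1
      have hpow : θ ^ Δ * g M ≤ g S := by
        have h := pow_card_mul_le_of_insert g hθ0.le ih M N
          (Finset.disjoint_filter_filter_not S S _).symm (by rw [hMN]; lia)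
        rw [hMN] at h
        exact (mul_le_mul_of_nonneg_right (pow_le_pow_of_le_one hθ0.le hθ1.le hN)
          measureReal_nonneg).trans h
      have hclosed : g S - g (insert x S) ≤ g M - g (insert x M) := by
        rw [g_closed, g_closed]
        exact measureReal_mono fun η h => ⟨h.1, fun s hs => h.2 s (Finset.filter_subset _ _ hs)⟩
      rw [g_insert x M (fun h => hx (Finset.filter_subset _ _ h))
        (fun s hs => (Finset.mem_filter.mp hs).2)] at hclosed
      have hM0 : 0 ≤ g M := measureReal_nonneg
      have hbound : g M - g {x} * g M ≤ (1 - θ) * g S :=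
        calc g M - g {x} * g M = (1 - g {x}) * g M := by ring
          _ ≤ ((1 - θ) * θ ^ Δ) * g M :=
            mul_le_mul_of_nonneg_right (by linarith [g_single x]) hM0
          _ = (1 - θ) * (θ ^ Δ * g M) := by ring
          _ ≤ (1 - θ) * g S := mul_le_mul_of_nonneg_left hpow (by linarith)
      linarith
  intro x S hx
  have h := ENNReal.ofReal_le_ofReal (key _ x S hx (Nat.lt_succ_self _))
  rw [ENNReal.ofReal_mul hθ0.le] at h
  simpa [hg, ofReal_measureReal] using h
end
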